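/- For every Boolean function f: {0,1}^n → {0,1}, the minimal depth of a XOR decision tree computing f is at least deg_2(f), the degree of the polynomial representing f over F_2. In particular, D^{XOR}(BPM_n) = n². -/

import Mathlib

open Finset
open scoped Classical

/-- Edges of the complete bipartite graph `K_{n,n}` on labeled parts of size `n`. -/
abbrev Edge (n : ℕ) := Fin n × Fin n

/-- `M` is (the edge set of) a perfect matching of `K_{n,n}`. -/
def isPM {n : ℕ} (M : Finset (Edge n)) : Prop :=
  ∃ σ : Equiv.Perm (Fin n), M = Finset.univ.image fun i => (i, σ i)

/-- `G` is matching-covered: its edge set is a (nonempty) union of perfect matchings. -/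
def matchingCovered {n : ℕ} (G : Finset (Edge n)) : Prop :=
  ∃ S : Finset (Finset (Edge n)), S.Nonempty ∧ (∀ M ∈ S, isPM M) ∧ S.sup id = G

/-- `G` contains a perfect matching. -/
def hasPM {n : ℕ} (G : Finset (Edge n)) : Prop :=
  ∃ σ : Equiv.Perm (Fin n), ∀ i, (i, σ i) ∈ G

/-- The bipartite graph on the vertex set `Fin n ⊕ Fin n` with edge set `G`. -/
def graphOn {n : ℕ} (G : Finset (Edge n)) : SimpleGraph (Fin n ⊕ Fin n) :=
  SimpleGraph.fromRel fun u v => ∃ e ∈ G, u = Sum.inl e.1 ∧ v = Sum.inr e.2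

/-- The number of connected components of `G` (as a spanning subgraph of `K_{n,n}`). -/
noncomputable def numComponents {n : ℕ} (G : Finset (Edge n)) : ℕ :=
  Nat.card (graphOn G).ConnectedComponent

/-- The cyclomatic number `χ(G) = |E(G)| − |V(G)| + |C(G)|`. -/
noncomputable def cyclo {n : ℕ} (G : Finset (Edge n)) : ℤ :=
  (G.card : ℤ) + numComponents G - 2 * n

/-- `G` is elementary: a connected matching-covered graph. -/
def elementary {n : ℕ} (G : Finset (Edge n)) : Prop :=
  matchingCovered G ∧ (graphOn G).Connected

/-- The bipartite perfect matching decision function, on inputs `x : Edge n → Bool`. -/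
def BPMb (n : ℕ) (x : Edge n → Bool) : Prop :=
  ∃ σ : Equiv.Perm (Fin n), ∀ i, x (i, σ i) = true

/-- Decision trees whose internal nodes query a Boolean function of a subset of the bits. -/
inductive QTree (E : Type) : Type where
  | leaf : Bool → QTree E
  | node : Finset E → QTree E → QTree E → QTree E

/-- Depth of a generalized decision tree. -/
def QTree.depth {E : Type} : QTree E → ℕ
  | .leaf _ => 0
  | .node _ t0 t1 => max (QTree.depth t0) (QTree.depth t1) + 1

/-- Evaluation of a XOR decision tree: each internal node queries the parity `⊕_{i∈S} x i`. -/
noncomputable def QTree.xorEval {E : Type} [DecidableEq E] : QTree E → (E → Bool) → Bool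
  | .leaf b, _ => b
  | .node S t0 t1, x =>
      if (S.filter fun e => x e = true).card % 2 = 1 then QTree.xorEval t1 x
      else QTree.xorEval t0 x

section Families

variable {r : ℕ} {α : Type*} [DecidableEq α]

/-- Hall's condition for a finite family of finite sets. -/
def HallFamily (A : Fin r → Finset α) : Prop :=
  ∀ S : Finset (Fin r), S.card ≤ (S.biUnion A).card

/-- Hall's condition with surplus one. -/
def SurplusFamily (A : Fin r → Finset α) : Prop :=
  ∀ S : Finset (Fin r), S.Nonempty → S.card < (S.biUnion A).card

/-- The largest set of indices for which Hall's inequality is an equality. -/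
def maxTight (A : Fin r → Finset α) : Finset (Fin r) :=
  (Finset.univ.filter fun S : Finset (Fin r) => (S.biUnion A).card = S.card).sup id

theorem card_biUnion_submodular (A : Fin r → Finset α) (S T : Finset (Fin r)) :
    ((S ∪ T).biUnion A).card + ((S ∩ T).biUnion A).card
      ≤ (S.biUnion A).card + (T.biUnion A).card := by
  rw [Finset.union_biUnion, ← Finset.card_union_add_card_inter (S.biUnion A)]
  gcongr
  exact Finset.subset_inter (Finset.biUnion_subset_biUnion_of_subset_left _ Finset.inter_subset_left)
    (Finset.biUnion_subset_biUnion_of_subset_left _ Finset.inter_subset_right)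

theorem subset_maxTight {A : Fin r → Finset α} {S : Finset (Fin r)}
    (h : (S.biUnion A).card = S.card) : S ⊆ maxTight A :=
  Finset.le_sup (f := id) (Finset.mem_filter.2 ⟨Finset.mem_univ S, h⟩)

theorem HallFamily.card_biUnion_maxTight {A : Fin r → Finset α} (hA : HallFamily A) :
    ((maxTight A).biUnion A).card = (maxTight A).card := by
  unfold maxTight
  refine Finset.sup_induction (p := fun S : Finset (Fin r) => (S.biUnion A).card = S.card) (by simp) ?_ (by simp)
  intro S hS T hT
  have h1 := card_biUnion_submodular A S T
  have h2 := hA (S ∪ T)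
  have h3 := hA (S ∩ T)
  have h4 := Finset.card_union_add_card_inter S T
  simp only [Finset.sup_eq_union]
  omega

theorem HallFamily.surplus_iff {A : Fin r → Finset α} (hA : HallFamily A) :
    SurplusFamily A ↔ maxTight A = ∅ := by
  constructor
  · intro h
    by_contra hne
    have := h _ (Finset.nonempty_iff_ne_empty.2 hne)
    have := hA.card_biUnion_maxTight
    omega
  · intro h S hS
    refine lt_of_le_of_ne (hA S) fun heq => ?_
    have := subset_maxTight heq.symm
    rw [h, Finset.subset_empty] at this
    exact hS.ne_empty this

theorem SurplusFamily.hall {A : Fin r → Finset α} (hA : SurplusFamily A) : HallFamily A := by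
  intro S
  rcases S.eq_empty_or_nonempty with rfl | h
  · simp
  · exact (hA S h).le

theorem hallFamily_cons_iff (B : Finset α) (A : Fin r → Finset α) :
    HallFamily (Fin.cons B A : Fin (r + 1) → Finset α) ↔
      HallFamily A ∧ ∀ S : Finset (Fin r), S.card + 1 ≤ (B ∪ S.biUnion A).card := by
  have hmap : ∀ S : Finset (Fin r), (S.map (Fin.succEmb r)).biUnion
      (Fin.cons B A : Fin (r + 1) → Finset α) = S.biUnion A := by
    intro S
    ext a
    simp
  have h0 : ∀ S : Finset (Fin r), (0 : Fin (r + 1)) ∉ S.map (Fin.succEmb r) := by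
    intro S
    simp [Fin.succ_ne_zero]
  constructor
  · intro h
    refine ⟨fun S => ?_, fun S => ?_⟩
    · simpa [hmap] using h (S.map (Fin.succEmb r))
    · have := h (insert 0 (S.map (Fin.succEmb r)))
      rwa [Finset.card_insert_of_notMem (h0 S), Finset.card_map, Finset.biUnion_insert, hmap,
        Fin.cons_zero] at this
  · rintro ⟨h1, h2⟩ S
    obtain ⟨S', hS'⟩ : ∃ S' : Finset (Fin r), S.erase 0 = S'.map (Fin.succEmb r) := by
      refine ⟨Finset.univ.filter fun i => i.succ ∈ S, ?_⟩
      ext i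
      refine Fin.cases ?_ (fun i => ?_) i <;> simp [Fin.succ_ne_zero]
    by_cases hS : (0 : Fin (r + 1)) ∈ S
    · rw [← Finset.insert_erase hS, hS', Finset.card_insert_of_notMem (h0 S'), Finset.card_map,
        Finset.biUnion_insert, hmap, Fin.cons_zero]
      exact h2 S'
    · rw [Finset.erase_eq_of_notMem hS] at hS'
      rw [hS', hmap, Finset.card_map]
      exact h1 S'

theorem HallFamily.cons_iff {A : Fin r → Finset α} (hA : HallFamily A) (B : Finset α) :
    HallFamily (Fin.cons B A : Fin (r + 1) → Finset α) ↔ ¬ B ⊆ (maxTight A).biUnion A := by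
  rw [hallFamily_cons_iff]
  constructor
  · rintro ⟨-, h⟩ hB
    have := h (maxTight A)
    rw [Finset.union_eq_right.2 hB, hA.card_biUnion_maxTight] at this
    omega
  · refine fun hB => ⟨hA, fun S => ?_⟩
    by_contra hlt
    have h1 := hA S
    have h2 : S.biUnion A ⊆ B ∪ S.biUnion A := Finset.subset_union_right
    have h3 := Finset.card_le_card h2
    have h4 := Finset.eq_of_subset_of_card_le h2 (by omega)
    refine hB ((Finset.union_eq_right.1 h4.symm).trans ?_)
    exact Finset.biUnion_subset_biUnion_of_subset_left _ (subset_maxTight (by omega))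

/-- Toggle the membership of `j` in the `i`-th set of a family. -/
def toggleFamily (A : Fin r → Finset α) (i : Fin r) (j : α) : Fin r → Finset α :=
  Function.update A i (symmDiff (A i) {j})

theorem toggleFamily_toggleFamily (A : Fin r → Finset α) (i : Fin r) (j : α) :
    toggleFamily (toggleFamily A i j) i j = A := by
  simp [toggleFamily]

theorem toggleFamily_ne (A : Fin r → Finset α) (i : Fin r) (j : α) :
    toggleFamily A i j ≠ A := by
  intro h
  have := congrFun h i
  simp [toggleFamily] at this

theorem toggleFamily_subset {A : Fin r → Finset α} {C : Finset α} (h : ∀ k, A k ⊆ C) (i : Fin r)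
    {j : α} (hj : j ∈ C) (k : Fin r) : toggleFamily A i j k ⊆ C := by
  by_cases hk : k = i
  · subst hk
    intro a ha
    simp only [toggleFamily, Function.update_self, Finset.mem_symmDiff,
      Finset.mem_singleton] at ha
    rcases ha with ha | ha
    · exact h k ha.1
    · exact ha.1 ▸ hj
  · simpa [toggleFamily, hk] using h k

theorem biUnion_toggleFamily_of_notMem (A : Fin r → Finset α) {i : Fin r} (j : α)
    {S : Finset (Fin r)} (hi : i ∉ S) : S.biUnion (toggleFamily A i j) = S.biUnion A := by
  refine Finset.biUnion_congr rfl fun k hk => ?_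
  have : k ≠ i := fun h => hi (h ▸ hk)
  simp [toggleFamily, this]

theorem biUnion_toggleFamily_union (A : Fin r → Finset α) {i : Fin r} {j : α}
    {T : Finset (Fin r)} (hi : i ∉ T) (hj : j ∈ T.biUnion A) (S : Finset (Fin r)) :
    (S ∪ T).biUnion (toggleFamily A i j) = (S ∪ T).biUnion A := by
  rw [Finset.union_biUnion, Finset.union_biUnion, biUnion_toggleFamily_of_notMem A j hi]
  ext a
  by_cases ha : a ∈ T.biUnion A
  · simp only [Finset.mem_union, ha, or_true]
  · have haj : a ≠ j := fun h => ha (h ▸ hj)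
    simp only [Finset.mem_union, ha, or_false, Finset.mem_biUnion]
    refine exists_congr fun k => and_congr_right fun _ => ?_
    by_cases hk : k = i
    · subst hk
      simp [toggleFamily, Finset.mem_symmDiff, haj]
    · simp [toggleFamily, hk]

section Toggle

variable {A : Fin r → Finset α} {i : Fin r} {j : α}

theorem HallFamily.card_toggle (hA : HallFamily A) (hi : i ∉ maxTight A)
    (hj : j ∈ (maxTight A).biUnion A) (S : Finset (Fin r)) :
    ((S ∪ maxTight A).biUnion A).card + S.card
      ≤ (S.biUnion (toggleFamily A i j)).card + (S ∪ maxTight A).card := by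
  have h1 := card_biUnion_submodular (toggleFamily A i j) S (maxTight A)
  rw [biUnion_toggleFamily_union A hi hj, biUnion_toggleFamily_of_notMem A j hi,
    biUnion_toggleFamily_of_notMem A j (fun h => hi (Finset.mem_inter.1 h).2),
    hA.card_biUnion_maxTight] at h1
  have h2 := hA (S ∩ maxTight A)
  have h3 := Finset.card_union_add_card_inter S (maxTight A)
  omega

theorem HallFamily.toggle (hA : HallFamily A) (hi : i ∉ maxTight A)
    (hj : j ∈ (maxTight A).biUnion A) : HallFamily (toggleFamily A i j) := by
  intro S
  have h1 := hA.card_toggle hi hj S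
  have h2 := hA (S ∪ maxTight A)
  omega

theorem HallFamily.maxTight_toggle (hA : HallFamily A) (hi : i ∉ maxTight A)
    (hj : j ∈ (maxTight A).biUnion A) : maxTight (toggleFamily A i j) = maxTight A := by
  apply Finset.Subset.antisymm
  · set S := maxTight (toggleFamily A i j)
    have h1 := hA.card_toggle hi hj S
    have h2 := hA (S ∪ maxTight A)
    have h3 : (S.biUnion (toggleFamily A i j)).card = S.card :=
      (hA.toggle hi hj).card_biUnion_maxTight
    have h4 : S ∪ maxTight A ⊆ maxTight A := subset_maxTight (by omega)
    exact Finset.subset_union_left.trans h4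
  · apply subset_maxTight
    rw [biUnion_toggleFamily_of_notMem A j hi, hA.card_biUnion_maxTight]

end Toggle

theorem HallFamily.sum_powersetCard {A : Fin r → Finset α} (hA : HallFamily A) {C : Finset α}
    (hC : ∀ i, A i ⊆ C) :
    (∑ D ∈ C.powersetCard r, if (∀ i, A i ⊆ D) ∧ HallFamily A then (1 : ZMod 2) else 0)
      = if maxTight A = Finset.univ then 1 else 0 := by
  have huniv := hA Finset.univ
  rw [Finset.card_univ, Fintype.card_fin] at huniv
  have hsub : ∀ D : Finset α, (∀ i, A i ⊆ D) ↔ Finset.univ.biUnion A ⊆ D := by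
    simp
  have hD : ∀ D ∈ C.powersetCard r, (∀ i, A i ⊆ D) → D = Finset.univ.biUnion A := by
    intro D hD h
    refine (Finset.eq_of_subset_of_card_le ((hsub D).1 h) ?_).symm
    rw [(Finset.mem_powersetCard.1 hD).2]
    exact huniv
  by_cases hT : maxTight A = Finset.univ
  · have hcard := hA.card_biUnion_maxTight
    rw [hT, Finset.card_univ, Fintype.card_fin] at hcard
    rw [if_pos hT, Finset.sum_eq_single (Finset.univ.biUnion A)]
    · exact if_pos ⟨(hsub _).2 subset_rfl, hA⟩
    · intro D hDC hne
      exact if_neg fun h => hne (hD D hDC h.1)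
    · intro h
      exact (h (Finset.mem_powersetCard.2 ⟨(hsub C).1 hC, hcard⟩)).elim
  · rw [if_neg hT]
    refine Finset.sum_eq_zero fun D hDC => if_neg fun h => hT ?_
    rw [Finset.eq_univ_iff_forall]
    intro i
    refine subset_maxTight (S := Finset.univ) ?_ (Finset.mem_univ i)
    rw [← hD D hDC h.1, (Finset.mem_powersetCard.1 hDC).2, Finset.card_univ, Fintype.card_fin]

variable [Fintype α]

/-- The number modulo two of Hall families of `r` subsets of `C`. -/
noncomputable def hallParity (r : ℕ) (C : Finset α) : ZMod 2 :=
  ∑ A : Fin r → Finset α, if (∀ i, A i ⊆ C) ∧ HallFamily A then 1 else 0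

/-- The number modulo two of families of `r` subsets of `C` satisfying Hall's condition with
surplus one. -/
noncomputable def surplusParity (r : ℕ) (C : Finset α) : ZMod 2 :=
  ∑ A : Fin r → Finset α, if (∀ i, A i ⊆ C) ∧ SurplusFamily A then 1 else 0

theorem sum_not_subset {C N : Finset α} (hC : C.Nonempty) (hN : N ⊆ C) :
    (∑ B : Finset α, if B ⊆ C ∧ ¬ B ⊆ N then (1 : ZMod 2) else 0) = if N = ∅ then 1 else 0 := by
  have hpow : ∀ D : Finset α, (∑ B : Finset α, if B ⊆ D then (1 : ZMod 2) else 0)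
      = if D = ∅ then 1 else 0 := by
    intro D
    have : (Finset.univ.filter fun B : Finset α => B ⊆ D) = D.powerset := by
      ext; simp
    rw [Finset.sum_boole, this, Finset.card_powerset]
    push_cast
    rw [show (2 : ZMod 2) = 0 from rfl, zero_pow_eq]
    simp
  have h : ∀ B : Finset α, (if B ⊆ C ∧ ¬ B ⊆ N then (1 : ZMod 2) else 0)
      = (if B ⊆ C then 1 else 0) + (if B ⊆ N then 1 else 0) := by
    intro B
    by_cases h1 : B ⊆ N
    · simp only [h1, h1.trans hN, not_true_eq_false, and_false, if_true, if_false]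
      rfl
    · simp [h1]
  simp_rw [h]
  rw [Finset.sum_add_distrib, hpow, hpow, if_neg hC.ne_empty, zero_add]

theorem hallParity_succ (r : ℕ) {C : Finset α} (hC : C.Nonempty) :
    hallParity (r + 1) C = surplusParity r C := by
  unfold hallParity surplusParity
  rw [← (Fin.consEquiv fun _ : Fin (r + 1) => Finset α).sum_comp, Fintype.sum_prod_type_right]
  refine Finset.sum_congr rfl fun A _ => ?_
  have hcons : ∀ B : Finset α, (Fin.consEquiv fun _ : Fin (r + 1) => Finset α) (B, A)
      = (Fin.cons B A : Fin (r + 1) → Finset α) := fun _ => rfl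
  simp only [hcons, Fin.forall_fin_succ, Fin.cons_zero, Fin.cons_succ]
  by_cases hAC : ∀ i, A i ⊆ C
  · by_cases hA : HallFamily A
    · have hN : (maxTight A).biUnion A ⊆ C := Finset.biUnion_subset.2 fun i _ => hAC i
      have hiff : SurplusFamily A ↔ (maxTight A).biUnion A = ∅ := by
        rw [hA.surplus_iff, ← Finset.card_eq_zero, ← hA.card_biUnion_maxTight,
          Finset.card_eq_zero]
      simp only [hAC, hA.cons_iff, implies_true, and_true, true_and, hiff]
      exact sum_not_subset hC hN
    · have h1 : ¬ SurplusFamily A := fun h => hA h.hall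
      have h2 : ∀ B, ¬ HallFamily (Fin.cons B A : Fin (r + 1) → Finset α) :=
        fun B h => hA ((hallFamily_cons_iff B A).1 h).1
      simp [h1, h2]
  · simp [hAC]

theorem sum_intermediate_tight (r : ℕ) (C : Finset α) :
    (∑ A : Fin r → Finset α, if ((∀ i, A i ⊆ C) ∧ HallFamily A) ∧
      maxTight A ≠ ∅ ∧ maxTight A ≠ Finset.univ then (1 : ZMod 2) else 0) = 0 := by
  rw [← Finset.sum_filter]
  have hi : ∀ T : Finset (Fin r), ∃ i : Option (Fin r), T ≠ Finset.univ → ∃ k ∉ T, i = some k := by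
    intro T
    by_cases hT : T = Finset.univ
    · exact ⟨none, fun h => (h hT).elim⟩
    · obtain ⟨k, hk⟩ : ∃ k, k ∉ T := by
        by_contra! h
        exact hT (Finset.eq_univ_iff_forall.2 h)
      exact ⟨some k, fun _ => ⟨k, hk, rfl⟩⟩
  have hj : ∀ N : Finset α, ∃ j : Option α, N ≠ ∅ → ∃ a ∈ N, j = some a := by
    intro N
    rcases N.eq_empty_or_nonempty with rfl | ⟨a, ha⟩
    · exact ⟨none, fun h => (h rfl).elim⟩
    · exact ⟨some a, fun _ => ⟨a, ha, rfl⟩⟩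
  choose row hrow using hi
  choose col hcol using hj
  let g : (Fin r → Finset α) → (Fin r → Finset α) := fun A =>
    match row (maxTight A), col ((maxTight A).biUnion A) with
    | some i, some j => toggleFamily A i j
    | _, _ => A
  have key : ∀ A ∈ Finset.univ.filter fun A : Fin r → Finset α =>
      ((∀ i, A i ⊆ C) ∧ HallFamily A) ∧ maxTight A ≠ ∅ ∧ maxTight A ≠ Finset.univ,
      ∃ i j, i ∉ maxTight A ∧ j ∈ (maxTight A).biUnion A ∧ g A = toggleFamily A i j ∧
        g (toggleFamily A i j) = A := by
    intro A hA
    obtain ⟨⟨-, hH⟩, hne, hnu⟩ := (Finset.mem_filter.1 hA).2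
    obtain ⟨i, hi, hi'⟩ := hrow _ hnu
    have hN : (maxTight A).biUnion A ≠ ∅ := by
      rwa [Ne, ← Finset.card_eq_zero, hH.card_biUnion_maxTight, Finset.card_eq_zero]
    obtain ⟨j, hj, hj'⟩ := hcol _ hN
    refine ⟨i, j, hi, hj, ?_, ?_⟩
    · simp only [g, hi', hj']
    · simp only [g, hH.maxTight_toggle hi hj, biUnion_toggleFamily_of_notMem A j hi, hi', hj',
        toggleFamily_toggleFamily]
  refine Finset.sum_involution (fun A _ => g A) (fun _ _ => rfl) ?_ ?_ ?_
  · intro A hA _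
    obtain ⟨i, j, -, -, h, -⟩ := key A hA
    rw [h]
    exact toggleFamily_ne A i j
  · intro A hA
    obtain ⟨i, j, hi, hj, h, -⟩ := key A hA
    obtain ⟨⟨hC, hH⟩, hne, hnu⟩ := (Finset.mem_filter.1 hA).2
    have hjC : j ∈ C := (Finset.biUnion_subset.2 fun k _ => hC k : (maxTight A).biUnion A ⊆ C) hj
    simp only [h, Finset.mem_filter, Finset.mem_univ, true_and, hH.maxTight_toggle hi hj]
    exact ⟨⟨toggleFamily_subset hC i hjC, hH.toggle hi hj⟩, hne, hnu⟩
  · intro A hA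
    obtain ⟨i, j, -, -, h, h'⟩ := key A hA
    simp only [h, h']

theorem hallParity_eq_surplusParity_add (r : ℕ) (C : Finset α) :
    hallParity (r + 1) C
      = surplusParity (r + 1) C + ∑ D ∈ C.powersetCard (r + 1), hallParity (r + 1) D := by
  unfold hallParity surplusParity
  rw [Finset.sum_comm, ← Finset.sum_add_distrib]
  refine Eq.trans ?_ ((congrArg _ (sum_intermediate_tight (r + 1) C)).trans (add_zero _))
  rw [← Finset.sum_add_distrib]
  refine Finset.sum_congr rfl fun A _ => ?_
  by_cases hA : HallFamily A
  · by_cases hC : ∀ i, A i ⊆ C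
    · rw [hA.sum_powersetCard hC]
      have hne : (∅ : Finset (Fin (r + 1))) ≠ Finset.univ := Finset.univ_nonempty.ne_empty.symm
      simp only [hA, hC, hA.surplus_iff, implies_true, and_true, true_and, if_true]
      by_cases h1 : maxTight A = ∅
      · simp [h1, hne]
      · by_cases h2 : maxTight A = Finset.univ <;> simp [h1, h2, hne.symm]
    · rw [Finset.sum_eq_zero]
      · simp [hC]
      · refine fun D hD => if_neg fun h => hC fun i => (h.1 i).trans (Finset.mem_powersetCard.1 hD).1
  · have h1 : ¬ SurplusFamily A := fun h => hA h.hall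
    simp [hA, h1]

theorem surplusParity_zero (C : Finset α) : surplusParity 0 C = 1 := by
  have h : ∀ A : Fin 0 → Finset α, SurplusFamily A := by
    intro A S hS
    exact hS.elim fun i _ => i.elim0
  simp [surplusParity, h]

theorem hallParity_eq_zero {r : ℕ} {C : Finset α} (h : C.card < r) : hallParity r C = 0 := by
  refine Finset.sum_eq_zero fun A _ => if_neg fun ⟨hC, hA⟩ => ?_
  have h1 := hA Finset.univ
  have h2 := Finset.card_le_card (Finset.biUnion_subset.2 fun i _ => hC i :
    Finset.univ.biUnion A ⊆ C)
  rw [Finset.card_univ, Fintype.card_fin] at h1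
  omega

theorem sum_range_hallParity {C : Finset α} (hC : C.Nonempty) (k : ℕ) :
    ∑ r ∈ Finset.range k, ∑ D ∈ C.powersetCard (r + 1), hallParity (r + 1) D
      = 1 + hallParity (k + 1) C := by
  induction k with
  | zero =>
    rw [hallParity_succ 0 hC, surplusParity_zero]
    rfl
  | succ k ih =>
    rw [Finset.sum_range_succ, ih, hallParity_eq_surplusParity_add k C, hallParity_succ (k + 1) hC]
    generalize surplusParity (k + 1) C = a
    generalize ∑ D ∈ C.powersetCard (k + 1), hallParity (k + 1) D = b
    rw [add_assoc, add_assoc, CharTwo.add_self_eq_zero, add_zero]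

theorem hallParity_card (C : Finset α) : hallParity C.card C = 1 := by
  induction C using Finset.strongInduction with
  | H C ih =>
    rcases C.eq_empty_or_nonempty with rfl | hC
    · have h : ∀ A : Fin 0 → Finset α, HallFamily A := by
        intro A S
        simp [Finset.eq_empty_of_isEmpty S]
      have h0 : hallParity 0 (∅ : Finset α) = 1 := by simp [hallParity, h]
      exact h0
    · have h1 := sum_range_hallParity hC C.card
      rw [hallParity_eq_zero (Nat.lt_succ_self _), add_zero] at h1
      have h2 : ∑ D ∈ C.powerset, hallParity D.card D = 0 := by
        have h0 : hallParity 0 (∅ : Finset α) = 1 :=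
          ih ∅ (Finset.empty_ssubset.2 hC)
        rw [Finset.sum_powerset, Finset.sum_range_succ', Finset.powersetCard_zero,
          Finset.sum_singleton, Finset.card_empty, h0]
        rw [Finset.sum_congr rfl fun r _ => Finset.sum_congr rfl fun D hD => by
          rw [(Finset.mem_powersetCard.1 hD).2], h1]
        rfl
      have h3 : ∑ D ∈ C.powerset, (1 : ZMod 2) = 0 := by
        rw [Finset.sum_const, Finset.card_powerset, nsmul_one]
        push_cast
        rw [show (2 : ZMod 2) = 0 from rfl, zero_pow (Finset.card_ne_zero.2 hC)]
      rw [← Finset.add_sum_erase _ _ (Finset.mem_powerset_self C)] at h2 h3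
      rw [Finset.sum_congr rfl fun D hD => ih D (Finset.ssubset_iff_subset_ne.2
        ⟨Finset.mem_powerset.1 (Finset.mem_of_mem_erase hD), Finset.ne_of_mem_erase hD⟩)] at h2
      exact add_right_cancel (h2.trans h3.symm)

end Families

theorem BPMb_iff_hallFamily {n : ℕ} (x : Edge n → Bool) :
    BPMb n x ↔ HallFamily fun i => Finset.univ.filter fun j => x (i, j) = true := by
  unfold HallFamily
  rw [Finset.all_card_le_biUnion_card_iff_exists_injective]
  constructor
  · rintro ⟨σ, hσ⟩
    exact ⟨σ, σ.injective, by simpa using hσ⟩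
  · rintro ⟨f, hf, h⟩
    exact ⟨Equiv.ofBijective f (Finite.injective_iff_bijective.1 hf), by simpa using h⟩

theorem sum_BPMb (n : ℕ) : (∑ x : Edge n → Bool, if BPMb n x then (1 : ZMod 2) else 0) = 1 := by
  have h := hallParity_card (Finset.univ : Finset (Fin n))
  rw [Finset.card_univ, Fintype.card_fin] at h
  refine Eq.trans ?_ h
  refine Finset.sum_bij' (fun x _ i => Finset.univ.filter fun j => x (i, j) = true)
    (fun A _ e => decide (e.2 ∈ A e.1)) (by simp) (by simp) (by simp) ?_ ?_
  · intro A _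
    ext i j
    simp
  · intro x _
    simp [BPMb_iff_hallFamily]

section Trees

variable {E : Type} [DecidableEq E]

theorem QTree.exists_mvPolynomial (T : QTree E) :
    ∃ p : MvPolynomial E (ZMod 2), p.totalDegree ≤ T.depth ∧
      ∀ x : E → Bool, MvPolynomial.eval (fun e => if x e then 1 else 0) p
        = if T.xorEval x then 1 else 0 := by
  induction T with
  | leaf b =>
    refine ⟨MvPolynomial.C (if b then 1 else 0), ?_, fun x => ?_⟩
    · rw [MvPolynomial.totalDegree_C]
      exact Nat.zero_le _
    · rw [MvPolynomial.eval_C, QTree.xorEval]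
  | node S t0 t1 ih0 ih1 =>
    obtain ⟨p0, hd0, h0⟩ := ih0
    obtain ⟨p1, hd1, h1⟩ := ih1
    let L : MvPolynomial E (ZMod 2) := ∑ e ∈ S, MvPolynomial.X e
    have hL : L.totalDegree ≤ 1 :=
      MvPolynomial.totalDegree_finsetSum_le fun e _ => (MvPolynomial.totalDegree_X e).le
    refine ⟨p0 + L * (p1 + p0), ?_, fun x => ?_⟩
    · have h2 := MvPolynomial.totalDegree_add p0 (L * (p1 + p0))
      have h3 := MvPolynomial.totalDegree_mul L (p1 + p0)
      have h4 := MvPolynomial.totalDegree_add p1 p0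
      simp only [QTree.depth]
      omega
    · have hLx : MvPolynomial.eval (fun e => if x e then 1 else 0) L
          = (((S.filter fun e => x e = true).card : ℕ) : ZMod 2) := by
        simp [L, Finset.sum_boole]
      rw [map_add, map_mul, map_add, h0, h1, hLx, QTree.xorEval]
      by_cases hpar : (S.filter fun e => x e = true).card % 2 = 1
      · rw [if_pos hpar, ZMod.natCast_eq_one_iff_odd.2 (Nat.odd_iff.2 hpar), one_mul, add_comm,
          add_assoc, CharTwo.add_self_eq_zero, add_zero]
      · rw [if_neg hpar, ZMod.natCast_eq_zero_iff_even.2 (Nat.even_iff.2 (by omega)), zero_mul,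
          add_zero]

theorem QTree.sum_xorEval_eq_zero [Fintype E] (T : QTree E) {S : Finset E}
    (hS : T.depth < S.card) :
    ∑ x : E → Bool, (if T.xorEval x then (1 : ZMod 2) else 0) *
      ∏ e ∈ Sᶜ, (1 - if x e then 1 else 0) = 0 := by
  obtain ⟨p, hd, hp⟩ := T.exists_mvPolynomial
  let q : MvPolynomial E (ZMod 2) := p * ∏ e ∈ Sᶜ, (1 - MvPolynomial.X e)
  have hq : q.totalDegree < Fintype.card E := by
    have h1 := MvPolynomial.totalDegree_mul p (∏ e ∈ Sᶜ, (1 - MvPolynomial.X e))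
    have h2 := MvPolynomial.totalDegree_finsetProd Sᶜ
      fun e : E => (1 - MvPolynomial.X e : MvPolynomial E (ZMod 2))
    have h3 : ∑ e ∈ Sᶜ, (1 - MvPolynomial.X e : MvPolynomial E (ZMod 2)).totalDegree
        ≤ ∑ e ∈ Sᶜ, 1 := by
      refine Finset.sum_le_sum fun e _ => (MvPolynomial.totalDegree_sub _ _).trans ?_
      simp
    rw [Finset.sum_const, smul_eq_mul, mul_one] at h3
    have h4 := Finset.card_add_card_compl S
    exact lt_of_le_of_lt h1 (by omega)
  have hsum := MvPolynomial.sum_eval_eq_zero q (by simpa [ZMod.card] using hq)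
  refine Eq.trans ?_ hsum
  let bits : Bool ≃ ZMod 2 :=
    { toFun := fun b => if b then 1 else 0
      invFun := fun a => decide (a = 1)
      left_inv := by decide
      right_inv := by decide }
  rw [← (Equiv.arrowCongr (Equiv.refl E) bits).sum_comp]
  refine Finset.sum_congr rfl fun x _ => ?_
  have hx : (Equiv.arrowCongr (Equiv.refl E) bits) x = fun e => if x e then 1 else 0 := rfl
  rw [hx, map_mul, hp, map_prod]
  simp

theorem sum_monomial_mul_prod_compl [Fintype E] (R S : Finset E) :
    ∑ x : E → Bool, (∏ e ∈ R, if x e then (1 : ZMod 2) else 0) *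
      ∏ e ∈ Sᶜ, (1 - if x e then 1 else 0) = if R = S then 1 else 0 := by
  have h : ∀ x : E → Bool, (∏ e ∈ R, if x e then (1 : ZMod 2) else 0) *
      ∏ e ∈ Sᶜ, (1 - if x e then 1 else 0) = ∏ e, ((if e ∈ R then if x e then 1 else 0 else 1) *
        (if e ∈ S then 1 else 1 - if x e then 1 else 0)) := by
    intro x
    rw [Finset.prod_mul_distrib, Finset.prod_ite_mem, Finset.univ_inter]
    congr 1
    rw [← Finset.prod_subset (Finset.subset_univ Sᶜ)]
    · refine Finset.prod_congr rfl fun e he => ?_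
      rw [if_neg (Finset.mem_compl.1 he)]
    · intro e _ he
      rw [if_pos (by simpa using he)]
  simp_rw [h]
  rw [← Fintype.prod_sum fun e (b : Bool) => (if e ∈ R then if b then (1 : ZMod 2) else 0 else 1) *
        (if e ∈ S then 1 else 1 - if b then 1 else 0)]
  have hfac : ∀ e, (∑ b : Bool, (if e ∈ R then if b then (1 : ZMod 2) else 0 else 1) *
        (if e ∈ S then 1 else 1 - if b then 1 else 0)) = if e ∈ R ↔ e ∈ S then 1 else 0 := by
    intro e
    by_cases h1 : e ∈ R <;> by_cases h2 : e ∈ S <;> simp [h1, h2] <;> rfl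
  simp_rw [hfac]
  by_cases hRS : R = S
  · simp [hRS]
  · rw [if_neg hRS]
    obtain ⟨e, he⟩ : ∃ e, ¬ (e ∈ R ↔ e ∈ S) := by
      by_contra! h
      exact hRS (Finset.ext h)
    exact Finset.prod_eq_zero (Finset.mem_univ e) (if_neg he)

theorem QTree.exists_of_dependsOn (s : Finset E) :
    ∀ f : (E → Bool) → Bool, (∀ x y, (∀ e ∈ s, x e = y e) → f x = f y) →
      ∃ T : QTree E, (∀ x, T.xorEval x = f x) ∧ T.depth ≤ s.card := by
  induction s using Finset.induction_on with
  | empty =>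
    intro f hf
    exact ⟨.leaf (f fun _ => false), fun x => hf _ _ (by simp), by simp [QTree.depth]⟩
  | insert a s ha ih =>
    intro f hf
    have hres : ∀ b : Bool, ∃ T : QTree E,
        (∀ x, T.xorEval x = f (Function.update x a b)) ∧ T.depth ≤ s.card := by
      refine fun b => ih (fun x => f (Function.update x a b)) fun x y hxy => hf _ _ fun e he => ?_
      by_cases hea : e = a
      · simp [hea]
      · simpa [hea] using hxy e (Finset.mem_of_mem_insert_of_ne he hea)
    obtain ⟨T0, h0, hd0⟩ := hres false
    obtain ⟨T1, h1, hd1⟩ := hres true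
    refine ⟨.node {a} T0 T1, fun x => ?_, ?_⟩
    · rw [QTree.xorEval, h0, h1, Finset.filter_singleton]
      have hupd : f (Function.update x a (x a)) = f x := by rw [Function.update_eq_self]
      cases hx : x a <;> simp [← hupd, hx]
    · rw [Finset.card_insert_of_notMem ha]
      simp only [QTree.depth]
      omega

end Trees

/-- for every Boolean function `f`, the depth of any XOR decision tree
computing `f` is at least `deg₂(f)`, the degree of the (unique) multilinear polynomial
representing `f` over `𝔽₂`; in particular `D^{XOR}(BPM_n) = n²`. -/
theorem stmt14 (n : ℕ) :
    (∀ (m : ℕ) (f : (Fin m → Bool) → Bool) (b : Finset (Fin m) → ZMod 2),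
      (∀ x : Fin m → Bool,
        (∑ S : Finset (Fin m), b S * ∏ i ∈ S, (if x i then (1 : ZMod 2) else 0))
          = (if f x then 1 else 0)) →
      ∀ T : QTree (Fin m), (∀ x, T.xorEval x = f x) →
        ∀ S : Finset (Fin m), b S ≠ 0 → S.card ≤ T.depth) ∧
    (∀ T : QTree (Edge n), (∀ x, T.xorEval x = true ↔ BPMb n x) → n ^ 2 ≤ T.depth) ∧
    (∃ T : QTree (Edge n), (∀ x, T.xorEval x = true ↔ BPMb n x) ∧ T.depth ≤ n ^ 2) := by
  refine ⟨fun m f b hb T hT S hS => ?_, fun T hT => ?_, ?_⟩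
  · by_contra! hlt
    have h := T.sum_xorEval_eq_zero hlt
    simp only [hT, ← hb, Finset.sum_mul] at h
    rw [Finset.sum_comm] at h
    simp only [mul_assoc, ← Finset.mul_sum, sum_monomial_mul_prod_compl] at h
    simp only [mul_ite, mul_one, mul_zero, Finset.sum_ite_eq', Finset.mem_univ, if_true] at h
    exact hS h
  · by_contra! hlt
    have h := T.sum_xorEval_eq_zero (S := Finset.univ)
      (by simpa [Finset.card_univ, Fintype.card_prod, sq] using hlt)
    simp only [hT, Finset.compl_univ, Finset.prod_empty, mul_one] at h
    exact one_ne_zero ((sum_BPMb n).symm.trans h)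
  · obtain ⟨T, hT, hd⟩ := QTree.exists_of_dependsOn (Finset.univ : Finset (Edge n))
      (fun x => decide (BPMb n x)) fun x y hxy => by
        rw [funext fun e => hxy e (Finset.mem_univ e)]
    refine ⟨T, fun x => by rw [hT, decide_eq_true_iff], ?_⟩
    simpa [Finset.card_univ, Fintype.card_prod, sq] using hd
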